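/- Let I be an ideal of a commutative Noetherian ring R. If I is syzygetic and rt(I) ≤ 2, then rt(I) = 1, i.e., I is of linear type. -/

import Mathlib

open Polynomial MvPolynomial

/-- The kernel of the graded presentation `R[t₁,…,t_s] → 𝐑(I) ⊆ R[X]` of the Rees algebra
of the ideal generated by `f`, sending `tᵢ` to `(f i)·X`. -/
noncomputable def reesKer {R : Type*} [CommRing R] {s : ℕ} (f : Fin s → R) :
    Ideal (MvPolynomial (Fin s) R) :=
  RingHom.ker (MvPolynomial.aeval
    (fun i => Polynomial.C (f i) * Polynomial.X) : MvPolynomial (Fin s) R →ₐ[R] Polynomial R)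

/-- `L` is generated by its homogeneous elements of degree at most `N`. -/
def GenInDegLE {R : Type*} [CommRing R] {s : ℕ}
    (L : Ideal (MvPolynomial (Fin s) R)) (N : ℕ) : Prop :=
  L = Ideal.span {p | p ∈ L ∧ ∃ q ≤ N, MvPolynomial.IsHomogeneous p q}

/-- The relation type of an ideal `I`: the least `N ≥ 1` such that, for every finite
generating family of `I`, the ideal of equations of the corresponding presentation of the
Rees algebra is generated by its homogeneous elements of degree at most `N`. -/
noncomputable def relType {R : Type*} [CommRing R] (I : Ideal R) : ℕ :=
  sInf {N | 1 ≤ N ∧ ∀ (s : ℕ) (f : Fin s → R),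
    Ideal.span (Set.range f) = I → GenInDegLE (reesKer f) N}

/-- An ideal `I` is *syzygetic* if the canonical map `α₂ : S₂(I) → I²` is an isomorphism;
equivalently, for every presentation of the Rees algebra of `I`, the degree-`2` equations are
generated by the linear ones (`L₂ = S₁·L₁`, i.e. `E(I)₂ = 0`). -/
def Syzygetic {R : Type*} [CommRing R] (I : Ideal R) : Prop :=
  ∀ (s : ℕ) (f : Fin s → R), Ideal.span (Set.range f) = I →
    ∀ p ∈ reesKer f, p.IsHomogeneous 2 →
      p ∈ Ideal.span {q | q ∈ reesKer f ∧ q.IsHomogeneous 1}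

theorem mem_reesKer {R : Type*} [CommRing R] {s : ℕ} {f : Fin s → R}
    {p : MvPolynomial (Fin s) R} :
    p ∈ reesKer f ↔
      MvPolynomial.aeval (fun i => Polynomial.C (f i) * Polynomial.X : Fin s → R[X]) p = 0 :=
  Iff.rfl

theorem genInDegLE_of_le {R : Type*} [CommRing R] {s : ℕ}
    {L : Ideal (MvPolynomial (Fin s) R)} {N : ℕ}
    (h : L ≤ Ideal.span {p | p ∈ L ∧ ∃ q ≤ N, MvPolynomial.IsHomogeneous p q}) :
    GenInDegLE L N :=
  le_antisymm h (Ideal.span_le.2 fun _ hp => hp.1)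

/-- On a form of degree `n` the presentation of the Rees algebra is evaluation times `X ^ n`. -/
theorem aeval_C_mul_X_of_isHomogeneous {R : Type*} [CommRing R] {s : ℕ} (f : Fin s → R)
    {p : MvPolynomial (Fin s) R} {n : ℕ} (hp : p.IsHomogeneous n) :
    MvPolynomial.aeval (fun i => Polynomial.C (f i) * Polynomial.X : Fin s → R[X]) p =
      Polynomial.C (MvPolynomial.eval f p) * Polynomial.X ^ n := by
  rw [MvPolynomial.aeval_def, MvPolynomial.eval₂_eq, MvPolynomial.eval_eq, map_sum,
    Finset.sum_mul]
  refine Finset.sum_congr rfl fun d hd => ?_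
  have hdeg : ∑ i ∈ d.support, d i = n := by
    have := hp (MvPolynomial.mem_support_iff.1 hd)
    rwa [Finsupp.weight_apply, Finsupp.sum, Finset.sum_congr rfl (g := d) (by simp)] at this
  simp only [mul_pow, Finset.prod_mul_distrib, Finset.prod_pow_eq_pow_sum, hdeg, map_mul,
    map_prod, map_pow, Polynomial.algebraMap_eq, mul_assoc]

/-- The ideal of equations of the Rees algebra is homogeneous. -/
theorem homogeneousComponent_mem_reesKer {R : Type*} [CommRing R] {s : ℕ} {f : Fin s → R}
    {p : MvPolynomial (Fin s) R} (hp : p ∈ reesKer f) (n : ℕ) :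
    MvPolynomial.homogeneousComponent n p ∈ reesKer f := by
  rw [mem_reesKer, aeval_C_mul_X_of_isHomogeneous f
    (MvPolynomial.homogeneousComponent_isHomogeneous n p)]
  rcases lt_or_ge p.totalDegree n with hn | hn
  · simp [MvPolynomial.homogeneousComponent_eq_zero n p hn]
  rw [mem_reesKer, ← MvPolynomial.sum_homogeneousComponent p, map_sum,
    Finset.sum_congr rfl fun i _ => aeval_C_mul_X_of_isHomogeneous f
      (MvPolynomial.homogeneousComponent_isHomogeneous i p)] at hp
  have hc := congrArg (fun P => Polynomial.coeff P n) hp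
  simp only [Polynomial.finsetSum_coeff, Polynomial.coeff_C_mul_X_pow,
    Polynomial.coeff_zero, Finset.sum_ite_eq, Finset.mem_range, Nat.lt_succ_of_le hn,
    if_true] at hc
  rw [hc, map_zero, zero_mul]

theorem exists_genInDegLE_reesKer {R : Type*} [CommRing R] [IsNoetherianRing R] {s : ℕ}
    (f : Fin s → R) : ∃ N, 1 ≤ N ∧ GenInDegLE (reesKer f) N := by
  obtain ⟨S, hS⟩ := (isNoetherianRing_iff_ideal_fg _).1 inferInstance (reesKer f)
  refine ⟨S.sup MvPolynomial.totalDegree + 1, Nat.le_add_left _ _, genInDegLE_of_le ?_⟩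
  conv_lhs => rw [← hS]
  refine Ideal.span_le.2 fun p hp => ?_
  have hpL : p ∈ reesKer f := hS ▸ Ideal.subset_span hp
  rw [SetLike.mem_coe, ← MvPolynomial.sum_homogeneousComponent p]
  refine Ideal.sum_mem _ fun i hi => Ideal.subset_span
    ⟨homogeneousComponent_mem_reesKer hpL i, i, ?_,
      MvPolynomial.homogeneousComponent_isHomogeneous i p⟩
  exact (Nat.lt_succ_iff.1 (Finset.mem_range.1 hi)).trans
    ((Finset.le_sup (f := MvPolynomial.totalDegree) hp).trans (Nat.le_succ _))

theorem isHomogeneous_sum_C_mul_X {R : Type*} [CommRing R] {s : ℕ} (a : Fin s → R) :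
    (∑ i, MvPolynomial.C (a i) * MvPolynomial.X i : MvPolynomial (Fin s) R).IsHomogeneous 1 :=
  MvPolynomial.IsHomogeneous.sum _ _ _ fun i _ => by
    simpa using (MvPolynomial.isHomogeneous_C (Fin s) (a i)).mul (MvPolynomial.isHomogeneous_X R i)

/-- A linear change of generators is compatible with the presentations of the Rees algebra. -/
theorem aeval_aeval_sum_C_mul_X {R : Type*} [CommRing R] {s m : ℕ} {f : Fin s → R}
    {g : Fin m → R} {a : Fin s → Fin m → R} (ha : ∀ i, ∑ j, a i j * g j = f i)
    (p : MvPolynomial (Fin s) R) :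
    MvPolynomial.aeval (fun j => Polynomial.C (g j) * Polynomial.X : Fin m → R[X])
        (MvPolynomial.aeval (fun i => ∑ j, MvPolynomial.C (a i j) * MvPolynomial.X j :
          Fin s → MvPolynomial (Fin m) R) p) =
      MvPolynomial.aeval (fun i => Polynomial.C (f i) * Polynomial.X : Fin s → R[X]) p := by
  rw [← AlgHom.comp_apply]
  congr 1
  refine MvPolynomial.algHom_ext fun i => ?_
  simp [← ha, Finset.sum_mul, mul_assoc, Polynomial.algebraMap_eq]

/-- A degree bound for the equations of the Rees algebra is independent of the generators. -/
theorem genInDegLE_reesKer_of_span_eq {R : Type*} [CommRing R] {s m : ℕ} {f : Fin s → R}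
    {g : Fin m → R} (hfg : Ideal.span (Set.range f) = Ideal.span (Set.range g)) {N : ℕ}
    (hN : 1 ≤ N) (hf : GenInDegLE (reesKer f) N) : GenInDegLE (reesKer g) N := by
  have hfa : ∀ i, ∃ a : Fin m → R, ∑ j, a j * g j = f i := fun i =>
    Ideal.mem_span_range_iff_exists_fun.1 (hfg ▸ Ideal.subset_span (Set.mem_range_self i))
  have hgb : ∀ j, ∃ b : Fin s → R, ∑ i, b i * f i = g j := fun j =>
    Ideal.mem_span_range_iff_exists_fun.1 (hfg ▸ Ideal.subset_span (Set.mem_range_self j))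
  choose a ha using hfa
  choose b hb using hgb
  refine genInDegLE_of_le fun p hp => ?_
  set J := Ideal.span {p | p ∈ reesKer g ∧ ∃ q ≤ N, MvPolynomial.IsHomogeneous p q}
  let ψ : MvPolynomial (Fin s) R →ₐ[R] MvPolynomial (Fin m) R :=
    MvPolynomial.aeval fun i => ∑ j, MvPolynomial.C (a i j) * MvPolynomial.X j
  let χ : MvPolynomial (Fin m) R →ₐ[R] MvPolynomial (Fin s) R :=
    MvPolynomial.aeval fun j => ∑ i, MvPolynomial.C (b j i) * MvPolynomial.X i
  have hψhom : ∀ {q : MvPolynomial (Fin s) R} {n : ℕ}, q.IsHomogeneous n →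
      (ψ q).IsHomogeneous n := fun {q n} hq => by
    simpa only [one_mul] using hq.aeval (fun i => ∑ j, MvPolynomial.C (a i j) * MvPolynomial.X j)
      (n := 1) fun i => isHomogeneous_sum_C_mul_X (a i)
  have hψ : reesKer f ≤ J.comap ψ := by
    conv_lhs => rw [hf]
    refine Ideal.span_le.2 ?_
    rintro q ⟨hq, n, hn, hqn⟩
    exact Ideal.subset_span
      ⟨mem_reesKer.2 ((aeval_aeval_sum_C_mul_X ha q).trans hq), n, hn, hψhom hqn⟩
  have hψχ : ψ (χ p) ∈ J :=
    hψ (mem_reesKer.2 ((aeval_aeval_sum_C_mul_X hb p).trans hp))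
  have hmod : (Ideal.Quotient.mkₐ R J).comp (ψ.comp χ) = Ideal.Quotient.mkₐ R J := by
    refine MvPolynomial.algHom_ext fun j => Ideal.Quotient.eq.2 (Ideal.subset_span ⟨?_, 1, hN, ?_⟩)
    · rw [mem_reesKer, map_sub, sub_eq_zero]
      exact (aeval_aeval_sum_C_mul_X ha _).trans (aeval_aeval_sum_C_mul_X hb _)
    · refine MvPolynomial.IsHomogeneous.sub (hψhom ?_) (MvPolynomial.isHomogeneous_X R j)
      simpa [χ] using isHomogeneous_sum_C_mul_X (b j)
  have := DFunLike.congr_fun hmod p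
  exact Ideal.Quotient.eq_zero_iff_mem.1 (this.symm.trans (Ideal.Quotient.eq_zero_iff_mem.2 hψχ))

/-- The infimum defining the relation type of an ideal of a Noetherian ring is attained. -/
theorem relType_mem {R : Type*} [CommRing R] [IsNoetherianRing R] (I : Ideal R) :
    1 ≤ relType I ∧ ∀ (s : ℕ) (f : Fin s → R),
      Ideal.span (Set.range f) = I → GenInDegLE (reesKer f) (relType I) := by
  obtain ⟨s, f, hf⟩ := Submodule.fg_iff_exists_fin_generating_family.1
    ((isNoetherianRing_iff_ideal_fg R).1 inferInstance I)
  obtain ⟨N, hN, hL⟩ := exists_genInDegLE_reesKer f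
  exact Nat.sInf_mem (s := {N | 1 ≤ N ∧ ∀ (s : ℕ) (f : Fin s → R),
    Ideal.span (Set.range f) = I → GenInDegLE (reesKer f) N})
    ⟨N, hN, fun _ _ hg => genInDegLE_reesKer_of_span_eq (hf.trans hg.symm) hN hL⟩

/-- If an ideal `I` of a commutative Noetherian ring is syzygetic and `rt(I) ≤ 2`, then
`rt(I) = 1`, i.e. `I` is of linear type. -/
theorem relType_eq_one_of_syzygetic {R : Type*} [CommRing R] [IsNoetherianRing R]
    (I : Ideal R) (hsyz : Syzygetic I) (hrt : relType I ≤ 2) :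
    relType I = 1 := by
  obtain ⟨hpos, hgen⟩ := relType_mem I
  refine le_antisymm (Nat.sInf_le ⟨le_rfl, fun s f hf => genInDegLE_of_le ?_⟩) hpos
  conv_lhs => rw [hgen s f hf]
  refine Ideal.span_le.2 ?_
  rintro p ⟨hp, q, hq, hpq⟩
  rcases Nat.lt_or_ge 1 q with h | h
  · obtain rfl : q = 2 := by omega
    refine Ideal.span_mono ?_ (hsyz s f hf p hp hpq)
    exact fun r hr => ⟨hr.1, 1, le_rfl, hr.2⟩
  · exact Ideal.subset_span ⟨hp, q, h, hpq⟩
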